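/- arXiv:0907.0292 — 2 statements merged into one kernel-verified Lean document; each statement's English description precedes it below -/
import Mathlib

section
/- Let N ≥ 1, d ≥ 1, H ∈ (1/2,1), T > 0 and r > d/2 − 1 + 1/(2H). For u = (u_1,…,u_N), v = (v_1,…,v_N) ∈ [0,T]^N set Q_H(u,v) = ∏_{i=1}^N u_i^{2H} + ∏_{i=1}^N v_i^{2H} − 2 ∏_{i=1}^N R_H(u_i,v_i), where R_H(a,b) = (1/2)(a^{2H}+b^{2H}−|a−b|^{2H}). Then ∫_{ℝ^d} (1+|x|²)^{−r} ( ∫_{[0,T]^N} ∫_{[0,T]^N} e^{−x_1² Q_H(u,v)/2} ∏_{i=1}^N |u_i−v_i|^{2H−2} du dv ) dx < ∞. (This is the finiteness of the term C_k in the proof that the current driven by the d-dimensional fractional Brownian sheet with N time parameters belongs to H^{−r}(ℝ^d;ℝ^d).) -/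
open MeasureTheory Real

/-- The covariance function of fractional Brownian motion with Hurst parameter `H`:
`R_H(a,b) = (1/2)(a^{2H}+b^{2H}−|a−b|^{2H})`. -/
noncomputable def fbmCov (H a b : ℝ) : ℝ :=
  (a ^ (2 * H) + b ^ (2 * H) - |a - b| ^ (2 * H)) / 2

/-- The variance `Q_H(u,v) = ∏ u_i^{2H} + ∏ v_i^{2H} − 2 ∏ R_H(u_i,v_i)` of the increment of
the `N`-parameter fractional Brownian sheet. -/
noncomputable def sheetIncrVar (H : ℝ) {N : ℕ} (u v : Fin N → ℝ) : ℝ :=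
  (∏ i, (u i) ^ (2 * H)) + (∏ i, (v i) ^ (2 * H)) - 2 * ∏ i, fbmCov H (u i) (v i)

lemma rpow_add_gap_of_le {H m M : ℝ} (hH : 0 < H) (hH1 : H < 1) (hm : 0 < m) (hmM : m ≤ M) :
    (2 - 2 ^ H) * m ^ H ≤ m ^ H + M ^ H - (m + M) ^ H := by
  have hM : 0 < M := hm.trans_le hmM
  have hconc := (Real.concaveOn_rpow hH.le hH1.le).2
  have ht0 : 0 ≤ (M - m) / M := div_nonneg (by linarith) hM.le
  have ht1 : 0 ≤ m / M := by positivity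
  have hsum : (M - m) / M + m / M = 1 := by field_simp; ring
  have hx : m ∈ Set.Ici (0 : ℝ) := hm.le
  have hy : m + M ∈ Set.Ici (0 : ℝ) := (by positivity : (0 : ℝ) ≤ m + M)
  have h1 := hconc hx hy ht1 ht0 (by linarith)
  have h2 := hconc hx hy ht0 ht1 hsum
  have e1 : m / M * m + (M - m) / M * (m + M) = M := by field_simp; ring
  have e2 : (M - m) / M * m + m / M * (m + M) = 2 * m := by field_simp; ring
  simp only [smul_eq_mul, e1, e2] at h1 h2
  rw [Real.mul_rpow (by norm_num) hm.le] at h2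
  have h3 : (M - m) / M = 1 - m / M := by linarith
  rw [h3] at h1 h2
  linarith

lemma rpow_add_gap {H a b : ℝ} (hH : 0 < H) (hH1 : H < 1) (ha : 0 < a) (hb : 0 < b) :
    (2 - 2 ^ H) * min (a ^ H) (b ^ H) ≤ a ^ H + b ^ H - (a + b) ^ H := by
  rcases le_total a b with h | h
  · rw [min_eq_left (Real.rpow_le_rpow ha.le h hH.le)]
    exact rpow_add_gap_of_le hH hH1 ha h
  · rw [min_eq_right (Real.rpow_le_rpow hb.le h hH.le)]
    have := rpow_add_gap_of_le hH hH1 hb h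
    rw [add_comm b a] at this
    linarith

lemma two_sub_two_rpow_pos {H : ℝ} (hH1 : H < 1) : 0 < 2 - (2 : ℝ) ^ H := by
  have := Real.rpow_lt_rpow_of_exponent_lt (x := 2) (by norm_num) hH1
  rw [Real.rpow_one] at this
  linarith

lemma rpow_two_mul {x : ℝ} (hx : 0 ≤ x) (H : ℝ) : x ^ (2 * H) = (x ^ H) ^ 2 := by
  rw [mul_comm, Real.rpow_mul hx, Real.rpow_two]

lemma fbmCov_comm (H a b : ℝ) : fbmCov H a b = fbmCov H b a := by
  simp only [fbmCov, abs_sub_comm a b]; ring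

lemma fbmCov_nonneg {H a b : ℝ} (hH : 0 < H) (ha : 0 < a) (hb : 0 < b) : 0 ≤ fbmCov H a b := by
  wlog h : a ≤ b generalizing a b
  · rw [fbmCov_comm]; exact this hb ha (le_of_not_ge h)
  have h1 : |a - b| ^ (2 * H) ≤ b ^ (2 * H) := by
    apply Real.rpow_le_rpow (abs_nonneg _) _ (by linarith)
    rw [abs_sub_comm, abs_of_nonneg] <;> linarith
  have h2 : 0 ≤ a ^ (2 * H) := by positivity
  unfold fbmCov
  linarith

lemma fbmCov_le {H a b : ℝ} (hH : 0 < H) (hH1 : H < 1) (ha : 0 < a) (hb : 0 < b) :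
    fbmCov H a b ≤ a ^ H * b ^ H := by
  wlog h : a ≤ b generalizing a b
  · rw [fbmCov_comm, mul_comm]; exact this hb ha (le_of_not_ge h)
  have h1 : b ^ H ≤ a ^ H + (b - a) ^ H := by
    have := Real.rpow_add_le_add_rpow ha.le (sub_nonneg.2 h) hH.le hH1.le
    rwa [add_sub_cancel] at this
  have h2 : a ^ H ≤ b ^ H := Real.rpow_le_rpow ha.le h hH.le
  rw [fbmCov, abs_sub_comm, abs_of_nonneg (sub_nonneg.2 h), rpow_two_mul ha.le, rpow_two_mul hb.le,
    rpow_two_mul (sub_nonneg.2 h)]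
  nlinarith [sub_nonneg.2 h1, sub_nonneg.2 h2]

/-- Strong local nondeterminism of fractional Brownian motion for two times: the Gram determinant
of two values is bounded below by the variance of the first times that of the increment. -/
lemma gram_fbmCov_ge {H u v : ℝ} (hH : 0 < H) (hH1 : H < 1) (hu : 0 < u) (huv : u < v) :
    (2 - 2 ^ H) / 2 * (u ^ (2 * H) * |u - v| ^ (2 * H)) ≤
      u ^ (2 * H) * v ^ (2 * H) - fbmCov H u v ^ 2 := by
  have hv : 0 < v := hu.trans huv
  have hs : 0 < v - u := sub_pos.2 huv
  have hgap := rpow_add_gap hH hH1 hu hs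
  rw [add_sub_cancel] at hgap
  have hc := two_sub_two_rpow_pos hH1
  rw [fbmCov, abs_sub_comm, abs_of_pos hs, rpow_two_mul hu.le, rpow_two_mul hv.le,
    rpow_two_mul hs.le]
  have hβα : u ^ H ≤ v ^ H := Real.rpow_le_rpow hu.le huv.le hH.le
  have hβσ : (v - u) ^ H ≤ v ^ H := Real.rpow_le_rpow hs.le (by linarith) hH.le
  have hα : 0 < u ^ H := by positivity
  have hσ : 0 < (v - u) ^ H := by positivity
  generalize u ^ H = α at *
  generalize v ^ H = β at *
  generalize (v - u) ^ H = σ at *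
  generalize 2 - (2 : ℝ) ^ H = c at *
  have hκ : 0 < min α σ := lt_min hα hσ
  have hκβ : α * σ ≤ min α σ * β := by
    rcases le_total α σ with h | h
    · rw [min_eq_left h]; gcongr
    · rw [min_eq_right h, mul_comm]; gcongr
  generalize min α σ = κ at *
  have hF1 : c * κ * σ ≤ (α + σ - β) * (σ + β - α) := by
    have : 0 ≤ α + σ - β := le_trans (by positivity) hgap
    gcongr
    linarith
  have hF2 : 2 * (α * β) ≤ (α + β) ^ 2 - σ ^ 2 := by nlinarith
  have hαβ : 0 ≤ 2 * (α * β) := by nlinarith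
  have hprod := mul_le_mul hF1 hF2 hαβ (le_trans (by positivity) hF1)
  have h4 : c * (α * σ) * (α * σ) ≤ c * (κ * β) * (α * σ) := by gcongr
  nlinarith

lemma quadratic_fbm_ge {H u v p q : ℝ} (hH : 0 < H) (hH1 : H < 1) (hu : 0 < u) (huv : u < v) :
    (2 - 2 ^ H) / 2 * (q ^ 2 * |u - v| ^ (2 * H)) ≤
      p ^ 2 * u ^ (2 * H) + q ^ 2 * v ^ (2 * H) - 2 * (p * q) * fbmCov H u v := by
  have hg := mul_le_mul_of_nonneg_left (gram_fbmCov_ge hH hH1 hu huv) (sq_nonneg q)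
  have ha : 0 < u ^ (2 * H) := by positivity
  refine le_of_mul_le_mul_left ?_ ha
  nlinarith [sq_nonneg (p * u ^ (2 * H) - q * fbmCov H u v)]

lemma quadratic_fbm_ge_min {H u v p q m : ℝ} (hH : 0 < H) (hH1 : H < 1) (hu : 0 < u) (hv : 0 < v)
    (hne : u ≠ v) (hm : 0 ≤ m) (hp : m ≤ p) (hq : m ≤ q) :
    (2 - 2 ^ H) / 2 * (m ^ 2 * |u - v| ^ (2 * H)) ≤
      p ^ 2 * u ^ (2 * H) + q ^ 2 * v ^ (2 * H) - 2 * (p * q) * fbmCov H u v := by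
  wlog h : u < v generalizing u v p q
  · have := this hv hu hne.symm hq hp (lt_of_le_of_ne (le_of_not_gt h) hne.symm)
    rw [abs_sub_comm, fbmCov_comm] at this
    linarith
  have hc := two_sub_two_rpow_pos hH1
  refine le_trans ?_ (quadratic_fbm_ge hH hH1 hu h)
  gcongr

lemma sheetIncrVar_ge {n : ℕ} {H : ℝ} (hH : 0 < H) (hH1 : H < 1) {u v : Fin (n + 1) → ℝ}
    (hu : ∀ i, 0 < u i) (hv : ∀ i, 0 < v i) (hne : u 0 ≠ v 0) :
    (2 - 2 ^ H) / 2 * (|u 0 - v 0| ^ (2 * H) *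
      ∏ i : Fin n, (min (u i.succ) (v i.succ)) ^ (2 * H)) ≤ sheetIncrVar H u v := by
  have hmin : ∀ i : Fin n, 0 < min (u i.succ) (v i.succ) := fun i => lt_min (hu _) (hv _)
  have key := quadratic_fbm_ge_min (p := ∏ i : Fin n, u i.succ ^ H)
    (q := ∏ i : Fin n, v i.succ ^ H) (m := ∏ i : Fin n, (min (u i.succ) (v i.succ)) ^ H)
    hH hH1 (hu 0) (hv 0) hne
    (Finset.prod_nonneg fun i _ => Real.rpow_nonneg (hmin i).le _)
    (Finset.prod_le_prod (fun i _ => Real.rpow_nonneg (hmin i).le _)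
      fun i _ => Real.rpow_le_rpow (hmin i).le (min_le_left _ _) hH.le)
    (Finset.prod_le_prod (fun i _ => Real.rpow_nonneg (hmin i).le _)
      fun i _ => Real.rpow_le_rpow (hmin i).le (min_le_right _ _) hH.le)
  simp only [← Finset.prod_pow, ← Finset.prod_mul_distrib] at key
  simp only [← rpow_two_mul (hu _).le, ← rpow_two_mul (hv _).le, ← rpow_two_mul (hmin _).le] at key
  have hR : fbmCov H (u 0) (v 0) * ∏ i : Fin n, fbmCov H (u i.succ) (v i.succ) ≤
      fbmCov H (u 0) (v 0) * ∏ i : Fin n, (u i.succ ^ H * v i.succ ^ H) :=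
    mul_le_mul_of_nonneg_left
      (Finset.prod_le_prod (fun i _ => fbmCov_nonneg hH (hu _) (hv _))
        fun i _ => fbmCov_le hH hH1 (hu _) (hv _)) (fbmCov_nonneg hH (hu _) (hv _))
  simp only [sheetIncrVar, Fin.prod_univ_succ (n := n)]
  linarith

/-- A lower bound on the sheet increment variance which treats all coordinates alike. -/
lemma sheetIncrVar_ge_prod {n : ℕ} {H T : ℝ} (hH : 0 < H) (hH1 : H < 1)
    {u v : Fin (n + 1) → ℝ} (hu : ∀ i, u i ∈ Set.Ioo 0 T) (hv : ∀ i, v i ∈ Set.Ioo 0 T)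
    (hne : u 0 ≠ v 0) :
    (2 - 2 ^ H) / 2 * ∏ i, (min (u i) (v i) * |u i - v i| / T) ^ (2 * H) ≤
      sheetIncrVar H u v := by
  refine le_trans ?_ (sheetIncrVar_ge hH hH1 (fun i => (hu i).1) (fun i => (hv i).1) hne)
  have hc := two_sub_two_rpow_pos hH1
  have hT : 0 < T := (hu 0).1.trans (hu 0).2
  have hmin : ∀ i, 0 < min (u i) (v i) := fun i => lt_min (hu i).1 (hv i).1
  have habs : ∀ i, |u i - v i| ≤ T := fun i => by
    rw [abs_le]; constructor <;> linarith [(hu i).1, (hu i).2, (hv i).1, (hv i).2]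
  have hz : ∀ i, 0 ≤ min (u i) (v i) * |u i - v i| / T := fun i => by
    have := hmin i; positivity
  rw [Fin.prod_univ_succ]
  refine mul_le_mul_of_nonneg_left (mul_le_mul ?_ ?_ ?_ ?_) (by positivity)
  · refine Real.rpow_le_rpow (hz 0) ?_ (by linarith)
    rw [div_le_iff₀ hT, mul_comm]
    exact mul_le_mul_of_nonneg_left ((min_le_left _ _).trans (hu 0).2.le) (abs_nonneg _)
  · refine Finset.prod_le_prod (fun i _ => Real.rpow_nonneg (hz _) _) fun i _ => ?_
    refine Real.rpow_le_rpow (hz _) ?_ (by linarith)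
    rw [div_le_iff₀ hT]
    exact mul_le_mul_of_nonneg_left (habs _) (hmin _).le
  · exact Finset.prod_nonneg fun i _ => Real.rpow_nonneg (hz _) _
  · positivity

lemma exp_neg_le_one_add_rpow {β y : ℝ} (hβ1 : β ≤ 1) (hy : 0 ≤ y) :
    Real.exp (-y) ≤ (1 + y) ^ (-β) := by
  have h1 : Real.exp (-y) ≤ (1 + y)⁻¹ := by
    rw [Real.exp_neg]
    gcongr
    linarith [Real.add_one_le_exp y]
  refine h1.trans ?_
  rw [← Real.rpow_neg_one]
  exact Real.rpow_le_rpow_of_exponent_le (by linarith) (by linarith)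

lemma exp_neg_le_prod_rpow {β c M x Q Z : ℝ} (hβ : 0 ≤ β) (hβ1 : β ≤ 1) (hc : 0 < c) (hc1 : c ≤ 1)
    (hM : 1 ≤ M) (hZ : 0 < Z) (hZM : Z ≤ M) (hQ : c * Z ≤ Q) :
    Real.exp (-(x ^ 2 * Q) / 2) ≤ (c / (2 * M)) ^ (-β) * Z ^ (-β) * (1 + x ^ 2) ^ (-β) := by
  have hM0 : 0 < M := by linarith
  have hQ0 : 0 ≤ Q := le_trans (by positivity) hQ
  have h1 : Real.exp (-(x ^ 2 * Q) / 2) ≤ (1 + x ^ 2 * Q / 2) ^ (-β) := by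
    have := exp_neg_le_one_add_rpow (y := x ^ 2 * Q / 2) hβ1 (by positivity)
    rwa [neg_div]
  refine h1.trans ?_
  rw [← Real.mul_rpow (by positivity) hZ.le, ← Real.mul_rpow (by positivity) (by positivity)]
  refine Real.rpow_le_rpow_of_nonpos (by positivity) ?_ (by linarith)
  have h2 : c / (2 * M) * Z ≤ 1 := by
    rw [div_mul_eq_mul_div, div_le_one (by positivity)]
    nlinarith
  have h3 : c / (2 * M) * Z ≤ Q / 2 := by
    rw [div_mul_eq_mul_div, div_le_div_iff₀ (by positivity) (by norm_num)]
    nlinarith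
  nlinarith [mul_le_mul_of_nonneg_left h3 (sq_nonneg x)]

open scoped ENNReal in
/-- Tonelli's theorem for a product of functions of one coordinate each. -/
lemma lintegral_fin_pi_prod {n : ℕ} (μ : Measure ℝ) [SigmaFinite μ] (f : Fin n → ℝ → ℝ≥0∞)
    (hf : ∀ i, Measurable (f i)) :
    ∫⁻ x, ∏ i, f i (x i) ∂(Measure.pi fun _ : Fin n => μ) = ∏ i, ∫⁻ t, f i t ∂μ := by
  induction n with
  | zero => simp
  | succ n ih =>
    have hmeas : Measurable fun y : Fin n → ℝ => ∏ i, f i.succ (y i) :=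
      Finset.measurable_prod _ fun i _ => (hf _).comp (measurable_pi_apply i)
    rw [← ((measurePreserving_piFinSuccAbove (fun _ : Fin (n + 1) => μ) 0).symm).lintegral_comp_emb
      (MeasurableEquiv.measurableEmbedding _), Fin.prod_univ_succ, ← ih _ fun i => hf _,
      ← lintegral_prod_mul (hf 0).aemeasurable hmeas.aemeasurable]
    simp_rw [MeasurableEquiv.piFinSuccAbove_symm_apply, Fin.insertNthEquiv,
      Fin.prod_univ_succ, Fin.insertNth_zero, Equiv.coe_fn_mk, Fin.cons_succ, Fin.cons_zero]
    rfl

/-- The one-coordinate factor dominating the integrand in the time variables. -/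
noncomputable def timeKernel (H T γ u v : ℝ) : ℝ :=
  (min u v * |u - v| / T) ^ (-γ) * |u - v| ^ (2 * H - 2)

lemma measurable_timeKernel (H T γ : ℝ) :
    Measurable fun z : ℝ × ℝ => ENNReal.ofReal (timeKernel H T γ z.1 z.2) := by
  unfold timeKernel
  fun_prop

lemma timeKernel_le {H T γ u v : ℝ} (hγ : 0 ≤ γ) (hu : u ∈ Set.Ioo 0 T) (hv : v ∈ Set.Ioo 0 T) :
    timeKernel H T γ u v ≤
      T ^ γ * (u ^ (-γ) * |u - v| ^ (2 * H - 2 - γ) + v ^ (-γ) * |u - v| ^ (2 * H - 2 - γ)) := by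
  obtain ⟨hu0, -⟩ := hu
  obtain ⟨hv0, hvT⟩ := hv
  have hT : 0 < T := hv0.trans hvT
  rcases eq_or_ne u v with rfl | hne
  · unfold timeKernel
    rcases hγ.eq_or_lt with rfl | hγ
    · have : 0 ≤ |u - u| ^ (2 * H - 2) := by positivity
      simp only [neg_zero, Real.rpow_zero, sub_zero, one_mul]
      linarith
    · have h0 : (0 : ℝ) ^ (-γ) = 0 := Real.zero_rpow (by linarith)
      rw [sub_self, abs_zero, mul_zero, zero_div, h0, zero_mul]
      positivity
  have hs : 0 < |u - v| := abs_pos.2 (sub_ne_zero.2 hne)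
  have hm : 0 < min u v := lt_min hu0 hv0
  have hmin : min u v ^ (-γ) ≤ u ^ (-γ) + v ^ (-γ) := by
    have h1 : 0 ≤ u ^ (-γ) := by positivity
    have h2 : 0 ≤ v ^ (-γ) := by positivity
    rcases min_choice u v with h | h <;> rw [h] <;> linarith
  have hsplit : |u - v| ^ (2 * H - 2 - γ) = |u - v| ^ (-γ) * |u - v| ^ (2 * H - 2) := by
    rw [← Real.rpow_add hs]; ring_nf
  unfold timeKernel
  rw [Real.div_rpow (by positivity) hT.le, Real.mul_rpow hm.le hs.le, ← add_mul, hsplit,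
    Real.rpow_neg hT.le, div_inv_eq_mul]
  calc min u v ^ (-γ) * |u - v| ^ (-γ) * T ^ γ * |u - v| ^ (2 * H - 2)
      = T ^ γ * (min u v ^ (-γ) * (|u - v| ^ (-γ) * |u - v| ^ (2 * H - 2))) := by ring
    _ ≤ _ := by gcongr

lemma setLIntegral_Ioo_rpow_lt_top {T a : ℝ} (ha : -1 < a) (hT : 0 < T) :
    ∫⁻ u in Set.Ioo 0 T, ENNReal.ofReal (u ^ a) < ⊤ := by
  refine IntegrableOn.setLIntegral_lt_top ?_
  exact (intervalIntegral.integrableOn_Ioo_rpow_iff hT).2 ha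

lemma setLIntegral_ball_abs_rpow_lt_top (T : ℝ) {a : ℝ} (ha : -1 < a) :
    ∫⁻ w in Metric.ball (0 : ℝ) T, ENNReal.ofReal (|w| ^ a) < ⊤ := by
  refine IntegrableOn.setLIntegral_lt_top ?_
  refine integrableOn_ball_of_norm_le_rpow (C := 1) (α := -a) (by simp) (by simp; linarith) ?_ ?_
  · refine Filter.Eventually.of_forall fun x => ?_
    rw [Real.norm_of_nonneg (by positivity), neg_neg, one_mul, Real.norm_eq_abs]
  · exact (by fun_prop : Measurable fun x : ℝ => |x| ^ a).aestronglyMeasurable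

lemma setLIntegral_abs_sub_rpow_le {T u : ℝ} (a : ℝ) (hu : u ∈ Set.Ioo 0 T) :
    ∫⁻ v in Set.Ioo 0 T, ENNReal.ofReal (|u - v| ^ a) ≤
      ∫⁻ w in Metric.ball (0 : ℝ) T, ENNReal.ofReal (|w| ^ a) := by
  have hmp : MeasurePreserving (fun v : ℝ => u - v) volume volume :=
    Measure.measurePreserving_sub_left volume u
  rw [← hmp.setLIntegral_comp_preimage Metric.isOpen_ball.measurableSet (by fun_prop)]
  refine lintegral_mono_set fun v hv => ?_
  rw [Set.mem_preimage, mem_ball_zero_iff, Real.norm_eq_abs, abs_lt]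
  constructor <;> linarith [hu.1, hu.2, hv.1, hv.2]

lemma lintegral_rpow_mul_abs_sub_lt_top {T γ a : ℝ} (hγ1 : γ < 1) (ha : -1 < a) (hT : 0 < T) :
    ∫⁻ u in Set.Ioo 0 T, ∫⁻ v in Set.Ioo 0 T, ENNReal.ofReal (u ^ (-γ) * |u - v| ^ a) < ⊤ := by
  set K := ∫⁻ w in Metric.ball (0 : ℝ) T, ENNReal.ofReal (|w| ^ a)
  calc ∫⁻ u in Set.Ioo 0 T, ∫⁻ v in Set.Ioo 0 T, ENNReal.ofReal (u ^ (-γ) * |u - v| ^ a)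
      ≤ ∫⁻ u in Set.Ioo 0 T, ENNReal.ofReal (u ^ (-γ)) * K := by
        refine setLIntegral_mono' measurableSet_Ioo fun u hu => ?_
        simp_rw [ENNReal.ofReal_mul (Real.rpow_nonneg hu.1.le _)]
        rw [lintegral_const_mul _ (by fun_prop)]
        gcongr
        exact setLIntegral_abs_sub_rpow_le a hu
    _ = (∫⁻ u in Set.Ioo 0 T, ENNReal.ofReal (u ^ (-γ))) * K :=
        lintegral_mul_const _ (by fun_prop)
    _ < ⊤ := ENNReal.mul_lt_top (setLIntegral_Ioo_rpow_lt_top (by linarith) hT)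
        (setLIntegral_ball_abs_rpow_lt_top T ha)

lemma lintegral_timeKernel_lt_top {H T γ : ℝ} (hH1 : H < 1) (hγ : 0 ≤ γ) (hγH : γ < 2 * H - 1)
    (hT : 0 < T) :
    ∫⁻ u in Set.Ioo 0 T, ∫⁻ v in Set.Ioo 0 T, ENNReal.ofReal (timeKernel H T γ u v) < ⊤ := by
  set a := 2 * H - 2 - γ with ha
  have hmain := lintegral_rpow_mul_abs_sub_lt_top (T := T) (γ := γ) (a := a) (by linarith)
    (by linarith) hT
  have hswap : ∫⁻ u in Set.Ioo 0 T, ∫⁻ v in Set.Ioo 0 T,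
      ENNReal.ofReal (v ^ (-γ) * |u - v| ^ a) < ⊤ := by
    rw [lintegral_lintegral_swap (by unfold Function.uncurry; fun_prop)]
    simpa only [abs_sub_comm] using hmain
  have hm : ∀ b : ℝ, Measurable fun z : ℝ × ℝ => ENNReal.ofReal (z.1 ^ b * |z.1 - z.2| ^ a) :=
    fun b => by fun_prop
  calc ∫⁻ u in Set.Ioo 0 T, ∫⁻ v in Set.Ioo 0 T, ENNReal.ofReal (timeKernel H T γ u v)
      ≤ ∫⁻ u in Set.Ioo 0 T, ∫⁻ v in Set.Ioo 0 T, ENNReal.ofReal (T ^ γ) *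
          (ENNReal.ofReal (u ^ (-γ) * |u - v| ^ a) + ENNReal.ofReal (v ^ (-γ) * |u - v| ^ a)) := by
        refine setLIntegral_mono' measurableSet_Ioo fun u hu => ?_
        refine setLIntegral_mono' measurableSet_Ioo fun v hv => ?_
        have hu0 := hu.1
        have hv0 := hv.1
        rw [← ENNReal.ofReal_add (by positivity) (by positivity),
          ← ENNReal.ofReal_mul (by positivity)]
        exact ENNReal.ofReal_le_ofReal (timeKernel_le hγ hu hv)
    _ = ENNReal.ofReal (T ^ γ) *
          ((∫⁻ u in Set.Ioo 0 T, ∫⁻ v in Set.Ioo 0 T, ENNReal.ofReal (u ^ (-γ) * |u - v| ^ a)) +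
            ∫⁻ u in Set.Ioo 0 T, ∫⁻ v in Set.Ioo 0 T, ENNReal.ofReal (v ^ (-γ) * |u - v| ^ a)) := by
        rw [← lintegral_add_left (hm (-γ)).lintegral_prod_right', ← lintegral_const_mul' _ _ (by simp)]
        refine lintegral_congr fun u => ?_
        rw [← lintegral_add_left (by fun_prop), ← lintegral_const_mul' _ _ (by simp)]
    _ < ⊤ := ENNReal.mul_lt_top (by simp) (ENNReal.add_lt_top.2 ⟨hmain, hswap⟩)

lemma lintegral_pi_timeKernel_lt_top {N : ℕ} {H T γ : ℝ} (hH1 : H < 1) (hγ : 0 ≤ γ)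
    (hγH : γ < 2 * H - 1) (hT : 0 < T) :
    ∫⁻ u : Fin N → ℝ in Set.univ.pi (fun _ => Set.Ioo (0 : ℝ) T),
      ∫⁻ v : Fin N → ℝ in Set.univ.pi (fun _ => Set.Ioo (0 : ℝ) T),
        ∏ i, ENNReal.ofReal (timeKernel H T γ (u i) (v i)) < ⊤ := by
  set ν : Measure ℝ := volume.restrict (Set.Ioo 0 T)
  have hres : (volume : Measure (Fin N → ℝ)).restrict
      (Set.univ.pi fun _ => Set.Ioo (0 : ℝ) T) = Measure.pi fun _ => ν :=
    Measure.restrict_pi_pi _ _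
  have hright : ∀ s, Measurable fun t => ENNReal.ofReal (timeKernel H T γ s t) := fun s => by
    unfold timeKernel
    fun_prop
  have hleft : Measurable fun s => ∫⁻ t, ENNReal.ofReal (timeKernel H T γ s t) ∂ν :=
    (measurable_timeKernel H T γ).lintegral_prod_right'
  have hinner : ∀ u : Fin N → ℝ, ∫⁻ v, ∏ i, ENNReal.ofReal (timeKernel H T γ (u i) (v i))
      ∂(Measure.pi fun _ : Fin N => ν) =
      ∏ i, ∫⁻ t, ENNReal.ofReal (timeKernel H T γ (u i) t) ∂ν := fun u =>
    lintegral_fin_pi_prod ν (fun i t => ENNReal.ofReal (timeKernel H T γ (u i) t))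
      fun i => hright (u i)
  rw [hres, lintegral_congr hinner, lintegral_fin_pi_prod ν
    (fun _ s => ∫⁻ t, ENNReal.ofReal (timeKernel H T γ s t) ∂ν) fun _ => hleft]
  exact ENNReal.prod_lt_top fun _ _ => lintegral_timeKernel_lt_top hH1 hγ hγH hT

lemma lintegral_euclidean_prod_rpow_lt_top (d : ℕ) {s : ℝ} (hs : 1 / 2 < s) :
    ∫⁻ x : EuclideanSpace ℝ (Fin d), ∏ i, ENNReal.ofReal ((1 + x i ^ 2) ^ (-s)) < ⊤ := by
  have hmp := PiLp.volume_preserving_ofLp (Fin d)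
  rw [hmp.lintegral_comp
    (f := fun y : Fin d → ℝ => ∏ i, ENNReal.ofReal ((1 + y i ^ 2) ^ (-s))) (by fun_prop),
    volume_pi, lintegral_fin_pi_prod _ (fun _ t => ENNReal.ofReal ((1 + t ^ 2) ^ (-s)))
      fun _ => by fun_prop]
  refine ENNReal.prod_lt_top fun _ _ => ?_
  have hint := integrable_rpow_neg_one_add_norm_sq (E := ℝ) (μ := volume) (r := 2 * s)
    (by simp; linarith)
  refine Integrable.lintegral_lt_top (hint.congr ?_)
  refine Filter.Eventually.of_forall fun t => ?_
  simp only [Real.norm_eq_abs, sq_abs]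
  ring_nf

lemma japanese_rpow_le_prod {m : ℕ} {r s β : ℝ} (hβ : β ≤ s) (hs : 0 ≤ s)
    (hr : r = (m + 1) * s - β) (x : EuclideanSpace ℝ (Fin (m + 1))) :
    (1 + ‖x‖ ^ 2) ^ (-r) * (1 + x 0 ^ 2) ^ (-β) ≤ ∏ i, (1 + x i ^ 2) ^ (-s) := by
  have hX : 0 < 1 + ‖x‖ ^ 2 := by positivity
  have hpos : ∀ i, 0 < 1 + x i ^ 2 := fun i => by positivity
  have hle : ∀ i, 1 + x i ^ 2 ≤ 1 + ‖x‖ ^ 2 := fun i => by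
    have := PiLp.norm_apply_le x i
    rw [Real.norm_eq_abs] at this
    have := pow_le_pow_left₀ (abs_nonneg _) this 2
    rw [sq_abs] at this
    linarith
  rw [Fin.prod_univ_succ]
  have h0 : (1 + x 0 ^ 2) ^ (-s) = (1 + x 0 ^ 2) ^ (-(s - β)) * (1 + x 0 ^ 2) ^ (-β) := by
    rw [← Real.rpow_add (hpos 0)]; ring_nf
  have hsplit : (1 + ‖x‖ ^ 2) ^ (-r) =
      (1 + ‖x‖ ^ 2) ^ (-(s - β)) * ∏ _i : Fin m, (1 + ‖x‖ ^ 2) ^ (-s) := by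
    rw [Finset.prod_const, Finset.card_univ, Fintype.card_fin, ← Real.rpow_natCast _ m,
      ← Real.rpow_mul hX.le, ← Real.rpow_add hX, hr]
    ring_nf
  have h1 : (1 + ‖x‖ ^ 2) ^ (-(s - β)) ≤ (1 + x 0 ^ 2) ^ (-(s - β)) :=
    Real.rpow_le_rpow_of_nonpos (hpos 0) (hle 0) (by linarith)
  have h2 : ∏ _i : Fin m, (1 + ‖x‖ ^ 2) ^ (-s) ≤ ∏ i : Fin m, (1 + x i.succ ^ 2) ^ (-s) :=
    Finset.prod_le_prod (fun i _ => by positivity)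
      fun i _ => Real.rpow_le_rpow_of_nonpos (hpos _) (hle _) (by linarith)
  have h3 : 0 ≤ (1 + x 0 ^ 2) ^ (-β) := Real.rpow_nonneg (hpos 0).le _
  rw [h0, hsplit]
  calc _ ≤ (1 + x 0 ^ 2) ^ (-(s - β)) * (∏ i : Fin m, (1 + x i.succ ^ 2) ^ (-s)) *
        (1 + x 0 ^ 2) ^ (-β) := by gcongr
    _ = _ := by ring

/-- Exponential factor and singular weight are dominated by a product of one-coordinate kernels
times a power of the spatial variable. -/
lemma exists_exp_mul_prod_le {n : ℕ} {H T β : ℝ} (hH : 1 / 2 < H) (hH1 : H < 1) (hT : 0 < T)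
    (hβ : 0 ≤ β) (hβ1 : β ≤ 1) :
    ∃ C : ℝ, 0 ≤ C ∧ ∀ (x : ℝ) (u v : Fin (n + 1) → ℝ),
      (∀ i, u i ∈ Set.Ioo 0 T) → (∀ i, v i ∈ Set.Ioo 0 T) →
      Real.exp (-(x ^ 2 * sheetIncrVar H u v) / 2) * ∏ i, |u i - v i| ^ (2 * H - 2) ≤
        C * (1 + x ^ 2) ^ (-β) * ∏ i, timeKernel H T (2 * H * β) (u i) (v i) := by
  have hc := two_sub_two_rpow_pos hH1
  have hH0 : 0 < H := by linarith
  have hc1 : (2 - (2 : ℝ) ^ H) / 2 ≤ 1 := by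
    have : (0 : ℝ) ≤ 2 ^ H := by positivity
    linarith
  set M := max 1 (∏ _i : Fin (n + 1), T ^ (2 * H))
  refine ⟨((2 - 2 ^ H) / 2 / (2 * M)) ^ (-β), by positivity, fun x u v hu hv => ?_⟩
  have hmin : ∀ i, 0 < min (u i) (v i) := fun i => lt_min (hu i).1 (hv i).1
  have hz : ∀ i, 0 ≤ min (u i) (v i) * |u i - v i| / T := fun i => by
    have := hmin i; positivity
  by_cases hne : ∀ i, u i ≠ v i
  · have hzpos : ∀ i, 0 < min (u i) (v i) * |u i - v i| / T := fun i => by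
      have := hmin i
      have := abs_pos.2 (sub_ne_zero.2 (hne i))
      positivity
    have hzT : ∀ i, min (u i) (v i) * |u i - v i| / T ≤ T := fun i => by
      have h1 : |u i - v i| ≤ T := by
        rw [abs_le]; constructor <;> linarith [(hu i).1, (hu i).2, (hv i).1, (hv i).2]
      have h2 : min (u i) (v i) ≤ T := (min_le_left _ _).trans (hu i).2.le
      rw [div_le_iff₀ hT]
      exact mul_le_mul h2 h1 (abs_nonneg _) hT.le
    have hexp := exp_neg_le_prod_rpow (x := x) hβ hβ1 (by positivity) hc1 (le_max_left _ _)
      (Finset.prod_pos fun i _ => Real.rpow_pos_of_pos (hzpos i) (2 * H))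
      (le_trans (Finset.prod_le_prod (fun i _ => Real.rpow_nonneg (hz i) _)
        fun i _ => Real.rpow_le_rpow (hz i) (hzT i) (by linarith)) (le_max_right _ _))
      (sheetIncrVar_ge_prod hH0 hH1 hu hv (hne 0))
    rw [← Real.finsetProd_rpow _ _ fun i _ => Real.rpow_nonneg (hz i) _] at hexp
    simp_rw [← Real.rpow_mul (hz _), mul_neg] at hexp
    simp only [timeKernel, Finset.prod_mul_distrib]
    have hw : 0 ≤ ∏ i, |u i - v i| ^ (2 * H - 2) :=
      Finset.prod_nonneg fun i _ => Real.rpow_nonneg (abs_nonneg _) _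
    refine (mul_le_mul_of_nonneg_right hexp hw).trans_eq ?_
    ring
  · push Not at hne
    obtain ⟨i, hi⟩ := hne
    have h0 : ∏ i, |u i - v i| ^ (2 * H - 2) = 0 :=
      Finset.prod_eq_zero (Finset.mem_univ i) (by
        rw [hi, sub_self, abs_zero, Real.zero_rpow (by linarith)])
    rw [h0, mul_zero]
    refine mul_nonneg (by positivity) (Finset.prod_nonneg fun j _ => ?_)
    exact mul_nonneg (Real.rpow_nonneg (hz j) _) (Real.rpow_nonneg (abs_nonneg _) _)

/-- for `N ≥ 1`, `d ≥ 1`, `H ∈ (1/2,1)`, `T > 0` and `r > d/2 − 1 + 1/(2H)`,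
`∫_{ℝ^d} (1+|x|²)^{−r} ( ∫_{[0,T]^N} ∫_{[0,T]^N} e^{−x₁² Q_H(u,v)/2}
  ∏_i |u_i−v_i|^{2H−2} du dv ) dx < ∞`. -/
theorem fbm_sheet_current_term_Ck_finite
    (N d : ℕ) (hN : 1 ≤ N) (hd : 1 ≤ d) (H T r : ℝ)
    (hH : 1 / 2 < H) (hH1 : H < 1) (hT : 0 < T)
    (hr : (d : ℝ) / 2 - 1 + 1 / (2 * H) < r) :
    ∫⁻ x : EuclideanSpace ℝ (Fin d),
      ∫⁻ u : Fin N → ℝ in Set.univ.pi (fun _ => Set.Icc (0 : ℝ) T),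
        ∫⁻ v : Fin N → ℝ in Set.univ.pi (fun _ => Set.Icc (0 : ℝ) T),
          ENNReal.ofReal ((1 + ‖x‖ ^ 2) ^ (-r) *
            Real.exp (-((x ⟨0, hd⟩) ^ 2 * sheetIncrVar H u v) / 2) *
            ∏ i, |u i - v i| ^ (2 * H - 2))
    < ⊤ := by
  obtain ⟨n, rfl⟩ : ∃ n, N = n + 1 := ⟨N - 1, by omega⟩
  obtain ⟨m, rfl⟩ : ∃ m, d = m + 1 := ⟨d - 1, by omega⟩
  have hH0 : 0 < H := by linarith
  have hinv : 1 / (2 * H) < 1 := by rw [div_lt_one] <;> linarith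
  have hinv2 : 1 / 2 < 1 / (2 * H) := by
    apply one_div_lt_one_div_of_lt <;> linarith
  obtain ⟨β, hβl, hβu⟩ : ∃ β, max 0 (((m + 1 : ℕ) : ℝ) / 2 - r) < β ∧ β < 1 - 1 / (2 * H) :=
    exists_between (max_lt (by linarith) (by linarith))
  obtain ⟨hβ0, hβr⟩ := max_lt_iff.1 hβl
  have hm : (0 : ℝ) < m + 1 := by positivity
  set s := (r + β) / (m + 1) with hs
  have hs2 : 1 / 2 < s := by
    push_cast at hβr
    rw [hs, lt_div_iff₀ hm]
    linarith
  have hrs : r = (m + 1) * s - β := by rw [hs]; field_simp; ring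
  have hγ : 2 * H * β < 2 * H - 1 := by
    have h := mul_lt_mul_of_pos_left hβu (by linarith : 0 < 2 * H)
    rwa [mul_sub, mul_one, mul_one_div_cancel (by linarith)] at h
  obtain ⟨C, hC, hbound⟩ := exists_exp_mul_prod_le (n := n) hH hH1 hT hβ0.le (by linarith)
  have hIoo : (Set.univ.pi fun _ : Fin (n + 1) => Set.Icc (0 : ℝ) T) =ᵐ[volume]
      Set.univ.pi fun _ : Fin (n + 1) => Set.Ioo (0 : ℝ) T :=
    Measure.pi_Ioo_ae_eq_pi_Icc.symm
  have hmeas : MeasurableSet (Set.univ.pi fun _ : Fin (n + 1) => Set.Ioo (0 : ℝ) T) :=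
    MeasurableSet.univ_pi fun _ => measurableSet_Ioo
  simp_rw [Measure.restrict_congr_set hIoo]
  set K := ∫⁻ u : Fin (n + 1) → ℝ in Set.univ.pi (fun _ => Set.Ioo (0 : ℝ) T),
      ∫⁻ v : Fin (n + 1) → ℝ in Set.univ.pi (fun _ => Set.Ioo (0 : ℝ) T),
        ∏ i, ENNReal.ofReal (timeKernel H T (2 * H * β) (u i) (v i)) with hK
  have hKtop : K < ⊤ := lintegral_pi_timeKernel_lt_top hH1 (by positivity) hγ hT
  have hpoint : ∀ (x : EuclideanSpace ℝ (Fin (m + 1))) (u v : Fin (n + 1) → ℝ),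
      (∀ i, u i ∈ Set.Ioo 0 T) → (∀ i, v i ∈ Set.Ioo 0 T) →
      ENNReal.ofReal ((1 + ‖x‖ ^ 2) ^ (-r) *
        Real.exp (-((x ⟨0, hd⟩) ^ 2 * sheetIncrVar H u v) / 2) *
        ∏ i, |u i - v i| ^ (2 * H - 2)) ≤
      (ENNReal.ofReal C * ∏ i, ENNReal.ofReal ((1 + x i ^ 2) ^ (-s))) *
        ∏ i, ENNReal.ofReal (timeKernel H T (2 * H * β) (u i) (v i)) := by
    intro x u v hu hv
    have hkn : ∀ i, 0 ≤ timeKernel H T (2 * H * β) (u i) (v i) := fun i => by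
      have : 0 < min (u i) (v i) := lt_min (hu i).1 (hv i).1
      unfold timeKernel
      positivity
    have hkp := Finset.prod_nonneg fun i (_ : i ∈ Finset.univ) => hkn i
    rw [← ENNReal.ofReal_prod_of_nonneg fun i _ => hkn i,
      ← ENNReal.ofReal_prod_of_nonneg fun i _ => Real.rpow_nonneg (by positivity) _,
      ← ENNReal.ofReal_mul hC, ← ENNReal.ofReal_mul (mul_nonneg hC (by positivity))]
    refine ENNReal.ofReal_le_ofReal ?_
    have hX : 0 ≤ (1 + ‖x‖ ^ 2) ^ (-r) := by positivity
    have h1 := mul_le_mul_of_nonneg_left (hbound (x 0) u v hu hv) hX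
    have h2 := mul_le_mul_of_nonneg_right
      (mul_le_mul_of_nonneg_left (japanese_rpow_le_prod (by linarith) (by linarith) hrs x) hC) hkp
    rw [mul_assoc]
    refine h1.trans (le_of_eq_of_le ?_ h2)
    ring
  calc _ ≤ ∫⁻ x : EuclideanSpace ℝ (Fin (m + 1)),
        (ENNReal.ofReal C * ∏ i, ENNReal.ofReal ((1 + x i ^ 2) ^ (-s))) * K := by
        refine lintegral_mono fun x => ?_
        have htop : ENNReal.ofReal C * ∏ i, ENNReal.ofReal ((1 + x i ^ 2) ^ (-s)) ≠ ⊤ :=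
          ENNReal.mul_ne_top (by simp) (ENNReal.prod_lt_top (by simp)).ne
        rw [hK, ← lintegral_const_mul' _ _ htop]
        refine setLIntegral_mono' hmeas fun u hu => ?_
        rw [← lintegral_const_mul' _ _ htop]
        refine setLIntegral_mono' hmeas fun v hv => ?_
        exact hpoint x u v (fun i => hu i trivial) (fun i => hv i trivial)
    _ = ENNReal.ofReal C * (∫⁻ x : EuclideanSpace ℝ (Fin (m + 1)),
          ∏ i, ENNReal.ofReal ((1 + x i ^ 2) ^ (-s))) * K := by
        rw [lintegral_mul_const' _ _ hKtop.ne, lintegral_const_mul' _ _ (by simp)]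
    _ < ⊤ := ENNReal.mul_lt_top (ENNReal.mul_lt_top (by simp)
        (lintegral_euclidean_prod_rpow_lt_top (m + 1) hs2)) hKtop
end

section
/- For every n ∈ ℕ and y ∈ ℝ, H_n(y) e^{−y²/2} = (−1)^{⌊n/2⌋} · (2^{n/2+1} / (n! √π)) · ∫_0^∞ u^n e^{−u²} g_n(u y √2) du, where g_n = cos if n is even and g_n = sin if n is odd. (This is the integral representation of Hermite functions used to bound |H_n(y)e^{−y²/2}| uniformly in y.) -/
open MeasureTheory Real

/-- The normalized Hermite polynomial
`H_n(x) = ((−1)^n/n!) e^{x²/2} (d^n/dx^n) e^{−x²/2}`. -/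
noncomputable def hermiteH (n : ℕ) (x : ℝ) : ℝ :=
  ((-1) ^ n / n.factorial) * Real.exp (x ^ 2 / 2) *
    iteratedDeriv n (fun y => Real.exp (-y ^ 2 / 2)) x

lemma integrable_pow_mul_exp_neg_sq (n : ℕ) :
    Integrable (fun u : ℝ => u ^ n * Real.exp (-u ^ 2)) := by
  have h := integrable_rpow_mul_exp_neg_mul_sq (b := 1) one_pos (s := n)
    (lt_of_lt_of_le (by norm_num) n.cast_nonneg)
  simpa using h

lemma integral_exp_neg_sq_mul_cos (c : ℝ) :
    ∫ u : ℝ, Real.exp (-u ^ 2) * Real.cos (c * u) = √π * Real.exp (-c ^ 2 / 4) := by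
  have h := fourierIntegral_gaussian (b := 1) (by simp) (c : ℂ)
  have hintegrand : Integrable fun u : ℝ =>
      Complex.exp (Complex.I * c * u) * Complex.exp (-1 * (u : ℂ) ^ 2) := by
    have hquad := integrable_cexp_quadratic (b := 1) (by simp) (Complex.I * c) 0
    refine hquad.congr (.of_forall fun u => ?_)
    simp only [← Complex.exp_add]
    ring_nf
  have hre := congrArg Complex.re h
  rw [show (∫ u : ℝ, Complex.exp (Complex.I * c * u) * Complex.exp (-1 * (u : ℂ) ^ 2)).re
    = ∫ u : ℝ, (Complex.exp (Complex.I * c * u) * Complex.exp (-1 * (u : ℂ) ^ 2)).re from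
    (integral_re hintegrand).symm] at hre
  have hr : ((π / 1 : ℂ) ^ (1 / 2 : ℂ) * Complex.exp (-(c : ℂ) ^ 2 / (4 * 1))).re
      = √π * Real.exp (-c ^ 2 / 4) := by
    rw [Real.sqrt_eq_rpow, ← Complex.ofReal_re (π ^ (1 / 2 : ℝ) * Real.exp (-c ^ 2 / 4))]
    push_cast [Complex.ofReal_cpow pi_pos.le]
    simp
  rw [hr] at hre
  rw [← hre]
  congr 1 with u
  rw [← Complex.exp_add, Complex.exp_re, Real.exp_eq_exp.2, mul_comm c u]
  · congr 2
    simp [← Complex.ofReal_pow, mul_comm]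
  · simp [← Complex.ofReal_pow]

lemma integral_Ioi_exp_neg_sq_mul_cos (c : ℝ) :
    ∫ u in Set.Ioi (0 : ℝ), Real.exp (-u ^ 2) * Real.cos (c * u)
      = √π / 2 * Real.exp (-c ^ 2 / 4) := by
  have h := integral_comp_abs (f := fun u : ℝ => Real.exp (-u ^ 2) * Real.cos (c * u))
  have habs (u : ℝ) : Real.cos (c * |u|) = Real.cos (c * u) := by
    rcases abs_choice u with hu | hu <;> simp [hu]
  simp only [sq_abs, habs, integral_exp_neg_sq_mul_cos] at h
  linarith

lemma hasDerivAt_integral_pow_mul_exp_neg_sq_mul_cos (n : ℕ) (b y : ℝ) :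
    HasDerivAt
      (fun y => ∫ u in Set.Ioi (0 : ℝ),
        u ^ n * Real.exp (-u ^ 2) * Real.cos (u * y * √2 + b))
      (∫ u in Set.Ioi (0 : ℝ),
        √2 * (u ^ (n + 1) * Real.exp (-u ^ 2) * Real.cos (u * y * √2 + (b + π / 2)))) y := by
  refine (hasDerivAt_integral_of_dominated_loc_of_deriv_le (s := Set.univ) (x₀ := y)
    (F' := fun y u => √2 *
      (u ^ (n + 1) * Real.exp (-u ^ 2) * Real.cos (u * y * √2 + (b + π / 2))))
    (bound := fun u => √2 * ‖u ^ (n + 1) * Real.exp (-u ^ 2)‖)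
    Filter.univ_mem (.of_forall fun x => ?_) ?_ ?_ (.of_forall fun u x _ => ?_)
    ((integrable_pow_mul_exp_neg_sq (n + 1)).norm.const_mul _).integrableOn
    (.of_forall fun u x _ => ?_)).2
  · exact Continuous.aestronglyMeasurable (by fun_prop)
  · refine Integrable.mono (integrable_pow_mul_exp_neg_sq n).integrableOn
      (Continuous.aestronglyMeasurable (by fun_prop)) (.of_forall fun u => ?_)
    rw [norm_mul]
    exact mul_le_of_le_one_right (norm_nonneg _) (Real.abs_cos_le_one _)
  · exact Continuous.aestronglyMeasurable (by fun_prop)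
  · rw [norm_mul, norm_mul _ (Real.cos _), Real.norm_of_nonneg (Real.sqrt_nonneg 2)]
    gcongr
    exact mul_le_of_le_one_right (norm_nonneg _) (Real.abs_cos_le_one _)
  · have h : HasDerivAt (fun x : ℝ => u * x * √2 + b) (u * 1 * √2) x :=
      (((hasDerivAt_id x).const_mul u).mul_const _).add_const b
    refine (h.cos.const_mul (u ^ n * Real.exp (-u ^ 2))).congr_deriv ?_
    rw [← add_assoc, Real.cos_add_pi_div_two]
    ring

lemma iteratedDeriv_gaussian_eq_integral (n : ℕ) :
    iteratedDeriv n (fun y : ℝ => Real.exp (-y ^ 2 / 2)) = fun y =>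
      2 / √π * √2 ^ n * ∫ u in Set.Ioi (0 : ℝ),
        u ^ n * Real.exp (-u ^ 2) * Real.cos (u * y * √2 + n * (π / 2)) := by
  induction n with
  | zero =>
    funext y
    have h := integral_Ioi_exp_neg_sq_mul_cos (y * √2)
    have hc : -(y * √2) ^ 2 / 4 = -y ^ 2 / 2 := by
      rw [mul_pow, Real.sq_sqrt zero_le_two]
      ring
    have hu (u : ℝ) : u * y * √2 = y * √2 * u := by ring
    have hπ : √π ≠ 0 := by positivity
    simp only [iteratedDeriv_zero, pow_zero, one_mul, mul_one, Nat.cast_zero, zero_mul, add_zero,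
      hu, h, hc]
    field_simp
  | succ n ih =>
    funext y
    rw [iteratedDeriv_succ, ih,
      ((hasDerivAt_integral_pow_mul_exp_neg_sq_mul_cos n (n * (π / 2)) y).const_mul _).deriv,
      integral_const_mul]
    have hphase : (n : ℝ) * (π / 2) + π / 2 = (n + 1 : ℕ) * (π / 2) := by
      push_cast
      ring
    rw [hphase]
    ring

lemma cos_add_nat_mul_pi_div_two (n : ℕ) (x : ℝ) :
    Real.cos (x + n * (π / 2)) =
      (-1) ^ n * (-1) ^ (n / 2) * if Even n then Real.cos x else Real.sin x := by
  rcases Nat.even_or_odd' n with ⟨k, rfl | rfl⟩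
  · have h : x + (2 * k : ℕ) * (π / 2) = x + k * π := by
      push_cast
      ring
    rw [h]
    simp [Real.cos_add_nat_mul_pi]
  · have h : x + (2 * k + 1 : ℕ) * (π / 2) = x + k * π + π / 2 := by
      push_cast
      ring
    have hk : (2 * k + 1) / 2 = k := by lia
    rw [h, hk, Real.cos_add_pi_div_two]
    simp [Real.sin_add_nat_mul_pi, pow_succ]

/-- integral representation of Hermite functions: for `n ∈ ℕ`, `y ∈ ℝ`,
`H_n(y) e^{−y²/2} = (−1)^{⌊n/2⌋} (2^{n/2+1}/(n!√π)) ∫_0^∞ u^n e^{−u²} g_n(uy√2) du`,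
where `g_n = cos` if `n` is even and `g_n = sin` if `n` is odd. -/
theorem hermite_function_integral_representation (n : ℕ) (y : ℝ) :
    hermiteH n y * Real.exp (-y ^ 2 / 2)
    = (-1) ^ (n / 2) * (2 ^ ((n : ℝ) / 2 + 1) / (n.factorial * Real.sqrt Real.pi)) *
        ∫ u in Set.Ioi (0 : ℝ), u ^ n * Real.exp (-u ^ 2) *
          (if Even n then Real.cos (u * y * Real.sqrt 2)
           else Real.sin (u * y * Real.sqrt 2)) := by
  have hsqrt : (2 : ℝ) ^ ((n : ℝ) / 2 + 1) = 2 * √2 ^ n := by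
    rw [Real.rpow_add_one two_ne_zero, Real.sqrt_eq_rpow, ← Real.rpow_mul_natCast zero_le_two]
    ring_nf
  have hexp : Real.exp (y ^ 2 / 2) * Real.exp (-y ^ 2 / 2) = 1 := by
    rw [← Real.exp_add]
    simp [neg_div]
  have hsign : ((-1 : ℝ) ^ n) * (-1) ^ n = 1 := by
    rw [← mul_pow]
    simp
  have hintegrand (u : ℝ) : u ^ n * Real.exp (-u ^ 2) * Real.cos (u * y * √2 + n * (π / 2)) =
      (-1) ^ n * (-1) ^ (n / 2) * (u ^ n * Real.exp (-u ^ 2) *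
        (if Even n then Real.cos (u * y * √2) else Real.sin (u * y * √2))) := by
    rw [cos_add_nat_mul_pi_div_two]
    ring
  simp only [hermiteH, iteratedDeriv_gaussian_eq_integral, hintegrand, integral_const_mul, hsqrt]
  generalize (∫ u in Set.Ioi (0 : ℝ), (_ : ℝ)) = J
  calc
    _ = (Real.exp (y ^ 2 / 2) * Real.exp (-y ^ 2 / 2)) * ((-1) ^ n * (-1) ^ n) *
        ((-1) ^ (n / 2) * (2 * √2 ^ n / (n.factorial * √π)) * J) := by
      ring
    _ = _ := by
      rw [hexp, hsign]
      ring
end
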